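/- arXiv:1102.0913 — 2 statements merged into one kernel-verified Lean document; each statement's English description precedes it below -/
import Mathlib

section
/- For every integer k > 0, let P_{k+1} be the set of words v such that v is a primitive of minimal length of some word u ∈ MF(C^∞) of height k. Then MF(C^{k+1}) = MF(C^k) ∪ P_{k+1}. -/
/- Common framework: words over the alphabet Σ = {1,2} (represented as natural
numbers), run-length encoding, the derivative D, k-differentiable words C^k,
C∞-words, heights, roots, primitives, minimal/maximal words, simple extensions,
minimal forbidden words, and the left frontier Ψ. -/

namespace CinftyWords

/-- A word is a finite sequence of natural numbers. -/
abbrev Word := List ℕ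

/-- `w` is a word over the alphabet Σ = {1,2}. -/
def IsWord (w : Word) : Prop := ∀ x ∈ w, x = 1 ∨ x = 2

/-- Complement of a letter: exchanges 1 and 2. -/
def bar (x : ℕ) : ℕ := 3 - x

/-- Letterwise complement of a word. -/
def comp (w : Word) : Word := w.map bar

/-- Run-length encoding Δ: the sequence of lengths of maximal runs of equal
consecutive letters. -/
def rle (w : Word) : Word := (w.splitBy (· == ·)).map List.length

/-- Drop the first run if it has length 1. -/
def dropFirstRun1 (g : List (List ℕ)) : List (List ℕ) :=
  match g with
  | [] => []
  | r :: rs => if r.length = 1 then rs else r :: rs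

/-- The derivative `D w`: the run-length encoding of the word obtained from `w`
by deleting its first and/or last run when that run has length 1. -/
def D (w : Word) : Word :=
  ((dropFirstRun1 ((dropFirstRun1 (w.splitBy (· == ·))).reverse)).reverse).map List.length

/-- `w` is differentiable: `w` is a word over Σ and so is its run-length encoding. -/
def Diffble (w : Word) : Prop := IsWord w ∧ IsWord (rle w)

/-- The set C^k of k-differentiable words: `D^[j] w` is differentiable for all `j < k`
(so that `D^[k] w` is defined). -/
def CK (k : ℕ) : Set Word := {w | IsWord w ∧ ∀ j < k, Diffble (D^[j] w)}

/-- The set C∞ of words differentiable arbitrarily many times. -/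
def Cinf : Set Word := {w | ∀ k : ℕ, w ∈ CK k}

/-- The height of a C∞-word: the least `k` with `D^[k] w = []`. -/
noncomputable def height (w : Word) : ℕ := sInf {k | D^[k] w = []}

/-- The root of a C∞-word: `D^[height w - 1] w`. -/
noncomputable def root (w : Word) : Word := D^[height w - 1] w

/-- `v` is a primitive of `w`: `v` is differentiable and `D v = w`. -/
def IsPrimitive (v w : Word) : Prop := Diffble v ∧ D v = w

/-- A nonempty C∞-word is maximal if each `D^[j] w` (for `j ≤ height w - 2`) is a
primitive of `D^[j+1] w` of maximal length (vacuously true when `height w = 1`). -/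
def MaximalWord (w : Word) : Prop :=
  w ∈ Cinf ∧ w ≠ [] ∧ ∀ j, j + 2 ≤ height w →
    ∀ v, IsPrimitive v (D^[j + 1] w) → v.length ≤ (D^[j] w).length

/-- A nonempty C∞-word is minimal if each `D^[j] w` (for `j ≤ height w - 2`) is a
primitive of `D^[j+1] w` of minimal length (vacuously true when `height w = 1`). -/
def MinimalWord (w : Word) : Prop :=
  w ∈ Cinf ∧ w ≠ [] ∧ ∀ j, j + 2 ≤ height w →
    ∀ v, IsPrimitive v (D^[j + 1] w) → (D^[j] w).length ≤ v.length

/-- `w` is right maximal: a suffix of a maximal word. -/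
def RightMaximal (w : Word) : Prop := ∃ v, MaximalWord v ∧ w <:+ v

/-- `w` is left maximal: a prefix of a maximal word. -/
def LeftMaximal (w : Word) : Prop := ∃ v, MaximalWord v ∧ w <+: v

/-- `w` is right minimal: a suffix of a minimal word. -/
def RightMinimal (w : Word) : Prop := ∃ v, MinimalWord v ∧ w <:+ v

/-- `w` is left minimal: a prefix of a minimal word. -/
def LeftMinimal (w : Word) : Prop := ∃ v, MinimalWord v ∧ w <+: v

/-- `w` is right doubly extendable: both `w1` and `w2` are C∞-words. -/
def RightDoublyExt (w : Word) : Prop := w ++ [1] ∈ Cinf ∧ w ++ [2] ∈ Cinf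

/-- `w` is left doubly extendable: both `1w` and `2w` are C∞-words. -/
def LeftDoublyExt (w : Word) : Prop := 1 :: w ∈ Cinf ∧ 2 :: w ∈ Cinf

/-- `w` is fully extendable: `1w1`, `1w2`, `2w1`, `2w2` are all C∞-words. -/
def FullyExt (w : Word) : Prop :=
  ∀ x, (x = 1 ∨ x = 2) → ∀ y, (y = 1 ∨ y = 2) → x :: (w ++ [y]) ∈ Cinf

/-- `w'` is a right simple extension of `w`: `w' = w ++ s` is a C∞-word and at each
step the extension by the complementary letter is not a C∞-word. -/
def RightSimpleExt (w w' : Word) : Prop :=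
  w' ∈ Cinf ∧ ∃ s : Word, IsWord s ∧ w' = w ++ s ∧
    ∀ i < s.length, w ++ s.take i ++ [bar (s.getD i 0)] ∉ Cinf

/-- `w'` is a left simple extension of `w`. -/
def LeftSimpleExt (w w' : Word) : Prop := RightSimpleExt w.reverse w'.reverse

/-- `w'` is a simple extension of `w`: a right simple extension of a left simple
extension of `w`. -/
def SimpleExt (w w' : Word) : Prop := ∃ v, LeftSimpleExt w v ∧ RightSimpleExt v w'

/-- `m` is the maximal extension of `w`: a simple extension of `w` of maximal length. -/
def IsMaximalExtension (w m : Word) : Prop :=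
  SimpleExt w m ∧ ∀ v, SimpleExt w v → v.length ≤ m.length

/-- A language is factorial if it is closed under taking factors. -/
def Factorial (F : Set Word) : Prop := ∀ v ∈ F, ∀ u, u <:+: v → u ∈ F

/-- A language is anti-factorial if no word of it is a proper factor of another
word of it. -/
def AntiFactorial (M : Set Word) : Prop := ∀ u ∈ M, ∀ v ∈ M, u ≠ v → ¬ u <:+: v

/-- The set of minimal forbidden words of a (factorial) language `F`: words not
in `F` whose maximal proper prefix and maximal proper suffix are both in `F`. -/
def MF (F : Set Word) : Set Word := {v | v ∉ F ∧ v.dropLast ∈ F ∧ v.tail ∈ F}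

/-- The height of a minimal forbidden word of C∞: `k + 1`, where `k` is the
(unique) integer such that `w` is k-differentiable and `D^[k] w ∈ {111, 222}`. -/
noncomputable def MFheight (w : Word) : ℕ :=
  sInf {k | w ∈ CK k ∧ (D^[k] w = [1, 1, 1] ∨ D^[k] w = [2, 2, 2])} + 1

/-- The left frontier Ψ of a C∞-word: the word of length `height w` over {0,1,2}
recording the first letter of each derivative, with `2` replaced by `0` when the
first two letters of the previous derivative are distinct. -/
noncomputable def psi (w : Word) : List ℕ :=
  (List.range (height w)).map (fun i =>
    if i = 0 then w.getD 0 0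
    else if (D^[i] w).getD 0 0 = 2 ∧ (D^[i - 1] w).getD 0 0 ≠ (D^[i - 1] w).getD 1 0 then 0
    else (D^[i] w).getD 0 0)

end CinftyWords

namespace CinftyWords

/-! ### Run-length encoding -/

theorem splitBy_cons_self (a : ℕ) (l : Word) : ∃ g gs,
    (a :: l).splitBy (· == ·) = g :: gs ∧ (a :: a :: l).splitBy (· == ·) = (a :: g) :: gs := by
  obtain ⟨g, gs, h⟩ := List.exists_cons_of_ne_nil
    (List.splitBy_ne_nil (r := (· == ·)).2 (List.cons_ne_nil a l))
  refine ⟨g, gs, h, ?_⟩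
  obtain ⟨hflat, hnil, hrun, hbreak⟩ := List.splitBy_eq_iff.1 h
  rw [List.splitBy_eq_iff]
  cases g with
  | nil => simp at hnil
  | cons b g =>
    simp only [List.flatten_cons, List.cons_append, List.cons.injEq] at hflat
    obtain ⟨rfl, hl⟩ := hflat
    refine ⟨by simp [hl], by simpa using hnil, ?_, ?_⟩
    · simp only [List.mem_cons, forall_eq_or_imp] at hrun ⊢
      exact ⟨by simpa using hrun.1, hrun.2⟩
    · cases gs with
      | nil => simp
      | cons c gs =>
        rw [List.isChain_cons_cons] at hbreak ⊢
        simpa using hbreak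

theorem splitBy_reverse (l : Word) :
    l.reverse.splitBy (· == ·) = ((l.splitBy (· == ·)).map List.reverse).reverse := by
  obtain ⟨hflat, hnil, hrun, hbreak⟩ := List.splitBy_eq_iff.1 (rfl : l.splitBy (· == ·) = _)
  rw [List.splitBy_eq_iff]
  refine ⟨?_, by simp, ?_, ?_⟩
  · conv_lhs => rw [hflat]
    rw [List.reverse_flatten]
  · simp only [List.mem_reverse, List.mem_map]
    rintro _ ⟨m, hm, rfl⟩
    rw [List.isChain_reverse]
    refine (hrun m hm).imp fun a b h => ?_
    rw [beq_iff_eq] at h ⊢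
    exact h.symm
  · rw [List.isChain_reverse, List.isChain_map]
    refine hbreak.imp fun a b ⟨ha, hb, h⟩ => ?_
    refine ⟨by simpa using hb, by simpa using ha, ?_⟩
    rw [beq_eq_false_iff_ne] at h ⊢
    simpa using h.symm

theorem rle_reverse (w : Word) : rle w.reverse = (rle w).reverse := by
  simp [rle, splitBy_reverse, Function.comp_def]

theorem rle_cons_ne {a : ℕ} {l : Word} (h : ∀ x ∈ l.head?, x ≠ a) :
    rle (a :: l) = 1 :: rle l := by
  have := List.splitBy_append (r := (· == ·)) (l := [a]) (m := l)
    (by simpa using fun x hx => (h x hx).symm)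
  simp only [List.singleton_append] at this
  simp [rle, this, List.splitBy_of_isChain]

theorem rle_cons_self (a : ℕ) (l : Word) :
    ∃ n s, rle (a :: l) = (n + 1) :: s ∧ rle (a :: a :: l) = (n + 2) :: s := by
  obtain ⟨g, gs, h, h'⟩ := splitBy_cons_self a l
  have hg : g ≠ [] := List.ne_nil_of_mem_splitBy (r := (· == ·)) (l := a :: l) (by simp [h])
  cases g with
  | nil => contradiction
  | cons b g => exact ⟨g.length, gs.map List.length, by simp [rle, h], by simp [rle, h']⟩

theorem rle_cons (a : ℕ) (l : Word) : rle (a :: l) = 1 :: rle l ∨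
    ∃ n s l', l = a :: l' ∧ rle l = (n + 1) :: s ∧ rle (a :: l) = (n + 2) :: s := by
  by_cases h : ∀ x ∈ l.head?, x ≠ a
  · exact .inl (rle_cons_ne h)
  · cases l with
    | nil => simp at h
    | cons b l =>
      obtain rfl : b = a := by simpa using h
      obtain ⟨n, s, h⟩ := rle_cons_self b l
      exact .inr ⟨n, s, l, rfl, h⟩

theorem sum_rle (w : Word) : (rle w).sum = w.length := by
  conv_rhs => rw [← List.flatten_splitBy (· == ·) w]
  rw [List.length_flatten, rle]

/-! ### Trimming runs of length one at the ends -/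

/-- Remove the first letter if it is `1`. -/
def trimLeft (r : Word) : Word := if r.head? = some 1 then r.tail else r

/-- Remove the last letter if it is `1`. -/
def trimRight (r : Word) : Word := (trimLeft r.reverse).reverse

theorem D_eq (w : Word) : D w = trimRight (trimLeft (rle w)) := by
  have h (G : List (List ℕ)) :
      (dropFirstRun1 G).map List.length = trimLeft (G.map List.length) := by
    cases G with
    | nil => rfl
    | cons g G => by_cases hg : g.length = 1 <;> simp [dropFirstRun1, trimLeft, hg]
  simp [D, trimRight, rle, h, List.map_reverse]

theorem trimRight_concat (r : Word) (b : ℕ) :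
    trimRight (r ++ [b]) = if b = 1 then r else r ++ [b] := by
  by_cases hb : b = 1 <;> simp [trimRight, trimLeft, hb]

theorem trimRight_nil : trimRight [] = [] := rfl

theorem trimLeft_trimRight (r : Word) : trimLeft (trimRight r) = trimRight (trimLeft r) := by
  rcases List.eq_nil_or_concat' r with rfl | ⟨m, b, rfl⟩
  · rfl
  rw [trimRight_concat]
  cases m with
  | nil => by_cases hb : b = 1 <;> simp [trimLeft, trimRight, hb]
  | cons a m =>
    have h := trimRight_concat (a :: m) b
    rw [List.cons_append] at h
    by_cases ha : a = 1 <;> by_cases hb : b = 1 <;>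
      simp_all [trimLeft, trimRight_concat]

theorem trimRight_tail (r : Word) : trimRight r.tail = (trimRight r).tail := by
  rcases List.eq_nil_or_concat' r with rfl | ⟨m, b, rfl⟩
  · rfl
  rw [trimRight_concat]
  cases m with
  | nil => by_cases hb : b = 1 <;> simp [hb, trimRight_nil]
  | cons a m =>
    by_cases hb : b = 1 <;> simp [hb, trimRight_concat]

theorem trimLeft_suffix (r : Word) : trimLeft r <:+ r := by
  unfold trimLeft
  split_ifs
  · exact r.tail_suffix
  · exact List.suffix_rfl

theorem trimRight_isPrefix (r : Word) : trimRight r <+: r := by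
  simpa [trimRight, ← List.reverse_suffix] using trimLeft_suffix r.reverse

theorem trimLeft_getLast? {r : Word} (h : trimLeft r ≠ []) :
    (trimLeft r).getLast? = r.getLast? := by
  obtain ⟨t, ht⟩ := trimLeft_suffix r
  conv_rhs => rw [← ht]
  rw [List.getLast?_append_of_ne_nil _ h]

theorem trimRight_head? {r : Word} (h : trimRight r ≠ []) :
    (trimRight r).head? = r.head? := by
  obtain ⟨t, ht⟩ := trimRight_isPrefix r
  conv_rhs => rw [← ht]
  rw [List.head?_append_of_ne_nil _ h]

theorem D_reverse (w : Word) : D w.reverse = (D w).reverse := by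
  rw [D_eq, D_eq, rle_reverse, ← trimLeft_trimRight (rle w)]
  simp [trimRight]

/-! ### Differentiable words -/

theorem IsWord.of_isInfix {u w : Word} (hw : IsWord w) (h : u <:+: w) : IsWord u :=
  fun x hx => hw x (h.subset hx)

theorem Diffble.reverse {w : Word} (h : Diffble w) : Diffble w.reverse := by
  simpa [Diffble, IsWord, rle_reverse] using h

theorem Diffble.isWord_D {w : Word} (h : Diffble w) : IsWord (D w) := by
  rw [D_eq]
  exact h.2.of_isInfix ((trimRight_isPrefix _).isInfix.trans (trimLeft_suffix _).isInfix)

theorem Diffble.tail {w : Word} (h : Diffble w) : Diffble w.tail := by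
  refine ⟨h.1.of_isInfix w.tail_suffix.isInfix, ?_⟩
  cases w with
  | nil => exact h.2
  | cons a l =>
    have h2 := h.2
    rcases rle_cons a l with hr | ⟨n, s, l', rfl, hl, hr⟩
    · rw [hr] at h2
      exact h2.of_isInfix (List.suffix_cons _ _).isInfix
    · rw [hr] at h2
      simp only [List.tail_cons, hl]
      simp only [IsWord, List.mem_cons, forall_eq_or_imp] at h2 ⊢
      exact ⟨by omega, h2.2⟩

theorem dropLast_eq_reverse (w : Word) : w.dropLast = w.reverse.tail.reverse := by simp

theorem Diffble.dropLast {w : Word} (h : Diffble w) : Diffble w.dropLast := by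
  rw [dropLast_eq_reverse]
  exact h.reverse.tail.reverse

theorem Diffble.D_tail {w : Word} (h : Diffble w) :
    D w.tail = D w ∨ D w.tail = (D w).tail := by
  suffices trimLeft (rle w.tail) = trimLeft (rle w) ∨
      trimLeft (rle w.tail) = (trimLeft (rle w)).tail by
    rw [D_eq, D_eq, ← trimRight_tail]
    exact this.imp (congrArg _) (congrArg _)
  cases w with
  | nil => exact .inl rfl
  | cons a l =>
    rcases rle_cons a l with hr | ⟨n, s, l', rfl, hl, hr⟩
    · by_cases h1 : (rle l).head? = some 1 <;> simp [hr, trimLeft, h1]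
    · have h2 := h.2 (n + 2) (by simp [hr])
      obtain rfl : n = 0 := by omega
      simp [hl, hr, trimLeft]

theorem Diffble.D_dropLast {w : Word} (h : Diffble w) :
    D w.dropLast = D w ∨ D w.dropLast = (D w).dropLast := by
  have := h.reverse.D_tail
  rw [dropLast_eq_reverse w, dropLast_eq_reverse (D w), D_reverse, ← D_reverse w]
  refine this.imp (fun h => ?_) (congrArg _)
  rw [h, D_reverse, List.reverse_reverse]

theorem head?_trimLeft_rle {w : Word} (h : D w.tail ≠ D w)
    (h1 : (rle w).head? = some 1) : (trimLeft (rle w)).head? = some 1 := by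
  cases w with
  | nil => simp at h
  | cons a l =>
    rcases rle_cons a l with hr | ⟨n, s, l', rfl, hl, hr⟩
    · have hf : trimLeft (rle (a :: l)) = rle l := by simp [hr, trimLeft]
      rw [hf]
      by_contra hne
      apply h
      rw [D_eq, D_eq, hf, List.tail_cons, trimLeft, if_neg hne]
    · simp [hr] at h1

/-! ### Lengths of primitives -/

/-- The number of letters `1` (zero or one) at the first position. -/
def leadingOne (r : Word) : ℕ := if r.head? = some 1 then 1 else 0

theorem sum_trimLeft_add_le (r : Word) : (trimLeft r).sum + leadingOne (trimLeft r) ≤ r.sum := by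
  by_cases h : r.head? = some 1
  · cases r with
    | nil => simp at h
    | cons a r =>
      obtain rfl : a = 1 := by simpa using h
      simp only [trimLeft, leadingOne, List.head?_cons, if_true, List.tail_cons, List.sum_cons]
      split_ifs <;> omega
  · simp [trimLeft, leadingOne, h]

theorem sum_trimLeft_add_eq {r : Word}
    (hr : r.head? = some 1 → (trimLeft r).head? = some 1) :
    (trimLeft r).sum + leadingOne (trimLeft r) = r.sum := by
  by_cases h : r.head? = some 1
  · have := hr h
    cases r with
    | nil => simp at h
    | cons a r =>
      obtain rfl : a = 1 := by simpa using h
      simp_all [trimLeft, leadingOne, add_comm]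
  · simp [trimLeft, leadingOne, h]

theorem sum_trimRight_add_le (r : Word) :
    (trimRight r).sum + leadingOne (trimRight r).reverse ≤ r.sum := by
  simpa [trimRight] using sum_trimLeft_add_le r.reverse

theorem sum_trimRight_add_eq {r : Word}
    (hr : r.getLast? = some 1 → (trimRight r).getLast? = some 1) :
    (trimRight r).sum + leadingOne (trimRight r).reverse = r.sum := by
  simpa [trimRight] using sum_trimLeft_add_eq (r := r.reverse) (by simpa [trimRight] using hr)

theorem sum_D_add_le_length {w : Word} (h : D w ≠ []) :
    (D w).sum + leadingOne (D w) + leadingOne (D w).reverse ≤ w.length := by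
  rw [← sum_rle]
  rw [D_eq] at h ⊢
  have h1 := sum_trimLeft_add_le (rle w)
  have h2 := sum_trimRight_add_le (trimLeft (rle w))
  have h3 : leadingOne (trimRight (trimLeft (rle w))) = leadingOne (trimLeft (rle w)) := by
    simp [leadingOne, trimRight_head? h]
  omega

theorem length_eq_sum_D_add {w : Word} (h : D w ≠ []) (hl : D w.tail ≠ D w)
    (hr : D w.dropLast ≠ D w) :
    (D w).sum + leadingOne (D w) + leadingOne (D w).reverse = w.length := by
  have hr' : D w.reverse.tail ≠ D w.reverse := fun e => hr <| by
    rw [dropLast_eq_reverse, D_reverse, e, D_reverse, List.reverse_reverse]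
  have hlast := head?_trimLeft_rle hr'
  have hhead := head?_trimLeft_rle hl
  rw [← sum_rle]
  rw [D_eq] at h ⊢
  have h1 := sum_trimLeft_add_eq hhead
  have h2 := sum_trimRight_add_eq (r := trimLeft (rle w)) fun e => by
    have hne : trimLeft (rle w) ≠ [] := fun e' => by simp [e'] at e
    rw [trimLeft_getLast? hne] at e
    have := hlast (by simpa [rle_reverse] using e)
    rw [← trimLeft_trimRight] at h ⊢
    rw [trimLeft_getLast? h]
    simpa [trimRight, rle_reverse] using this
  have h3 : leadingOne (trimRight (trimLeft (rle w))) = leadingOne (trimLeft (rle w)) := by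
    simp [leadingOne, trimRight_head? h]
  omega

/-- `v` is a primitive of `u` of minimal length. -/
def IsMinPrimitive (v u : Word) : Prop :=
  IsPrimitive v u ∧ ∀ v', IsPrimitive v' u → v.length ≤ v'.length

theorem isMinPrimitive_of_D_ne {w : Word} (hw : Diffble w) (h : D w ≠ [])
    (hl : D w.tail ≠ D w) (hr : D w.dropLast ≠ D w) : IsMinPrimitive w (D w) := by
  refine ⟨⟨hw, rfl⟩, fun v' hv' => ?_⟩
  rw [← length_eq_sum_D_add h hl hr, ← hv'.2]
  exact sum_D_add_le_length (hv'.2 ▸ h)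

theorem IsMinPrimitive.D_tail {v u : Word} (h : IsMinPrimitive v u) (hu : u ≠ []) :
    D v.tail = u.tail := by
  obtain ⟨⟨hv, rfl⟩, hmin⟩ := h
  refine hv.D_tail.resolve_left fun e => ?_
  have hlen := hmin _ ⟨hv.tail, e⟩
  cases v with
  | nil => exact hu rfl
  | cons a v => simp at hlen

theorem IsMinPrimitive.D_dropLast {v u : Word} (h : IsMinPrimitive v u) (hu : u ≠ []) :
    D v.dropLast = u.dropLast := by
  obtain ⟨⟨hv, rfl⟩, hmin⟩ := h
  refine hv.D_dropLast.resolve_left fun e => ?_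
  have hlen := hmin _ ⟨hv.dropLast, e⟩
  cases v with
  | nil => exact hu rfl
  | cons a v => simp at hlen

/-! ### The sets `C^k` -/

theorem mem_CK_zero {w : Word} : w ∈ CK 0 ↔ IsWord w := by simp [CK]

theorem mem_CK_succ {k : ℕ} {w : Word} : w ∈ CK (k + 1) ↔ Diffble w ∧ D w ∈ CK k := by
  simp only [CK, Set.mem_ofPred_eq]
  constructor
  · rintro ⟨-, h⟩
    have h0 : Diffble w := h 0 k.succ_pos
    exact ⟨h0, h0.isWord_D, fun j hj => h (j + 1) (by omega)⟩
  · rintro ⟨h0, -, h⟩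
    refine ⟨h0.1, fun j hj => ?_⟩
    cases j with
    | zero => exact h0
    | succ j => exact h j (by omega)

theorem CK_antitone : Antitone CK :=
  fun _ _ hab _ hw => ⟨hw.1, fun i hi => hw.2 i (hi.trans_le hab)⟩

theorem mem_CK_one {w : Word} : w ∈ CK 1 ↔ Diffble w := by
  rw [mem_CK_succ, mem_CK_zero]
  exact ⟨And.left, fun h => ⟨h, h.isWord_D⟩⟩

theorem nil_mem_CK (k : ℕ) : ([] : Word) ∈ CK k := by
  induction k with
  | zero => simp [mem_CK_zero, IsWord]
  | succ k ih => exact mem_CK_succ.2 ⟨by simp [Diffble, IsWord, rle], ih⟩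

theorem pair_mem_CK {a : ℕ} (ha : a = 1 ∨ a = 2) (k : ℕ) : [a, a] ∈ CK k := by
  refine CK_antitone (k.le_add_right 2) (mem_CK_succ.2 ⟨?_, mem_CK_succ.2 ?_⟩)
  · rcases ha with rfl | rfl <;> simp [Diffble, IsWord, rle, List.splitBy, List.splitBy.loop]
  · have : D [a, a] = [2] := by rcases ha with rfl | rfl <;> rfl
    rw [this]
    exact ⟨by simp [Diffble, IsWord, rle, List.splitBy, List.splitBy.loop], nil_mem_CK k⟩

/-! ### Minimal forbidden words -/

theorem not_diffble_cube {a : ℕ} (l : Word) : ¬ Diffble (a :: a :: a :: l) := fun h => by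
  obtain ⟨n, s, hn, hn'⟩ := rle_cons_self a l
  obtain ⟨m, t, hm, hm'⟩ := rle_cons_self a (a :: l)
  rw [hn'] at hm
  have := h.2 (m + 2) (by simp [hm'])
  simp only [List.cons.injEq] at hm
  omega

/-- A non-differentiable word with differentiable maximal proper prefix and suffix is either
a single letter outside the alphabet, or a cube of a letter of the alphabet. -/
theorem eq_singleton_or_cube {v : Word} (hv : ¬ Diffble v) (hp : Diffble v.dropLast)
    (hs : Diffble v.tail) :
    (∃ a, v = [a] ∧ ¬ IsWord v) ∨ v = [1, 1, 1] ∨ v = [2, 2, 2] := by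
  cases v with
  | nil => exact absurd hs hv
  | cons a l =>
    rw [List.tail_cons] at hs
    by_cases ha : a = 1 ∨ a = 2
    · right
      have hword : IsWord (a :: l) := by
        simpa [IsWord, ha] using hs.1
      have hrle : ¬ IsWord (rle (a :: l)) := fun h => hv ⟨hword, h⟩
      rcases rle_cons a l with hr | ⟨n, s, l', rfl, hl, hr⟩
      · exact absurd (by simpa [IsWord, hr] using hs.2) hrle
      rcases rle_cons a l' with hr' | ⟨m, t, l'', rfl, -, -⟩
      · refine absurd ?_ hrle
        rw [hl] at hr'
        have hs2 := hs.2
        simp only [List.cons.injEq, Nat.add_eq_right] at hr'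
        rw [hl] at hs2
        rw [hr]
        simp only [IsWord, List.mem_cons, forall_eq_or_imp] at hs2 ⊢
        exact ⟨by omega, hs2.2⟩
      cases l'' with
      | nil => rcases ha with rfl | rfl <;> simp
      | cons b l =>
        exact absurd (by simpa using hp) (not_diffble_cube _)
    · left
      cases l with
      | nil => exact ⟨a, rfl, by simpa [IsWord] using ha⟩
      | cons b l => exact absurd (hp.1 a (by simp)) ha

theorem singleton_mem_MF {a : ℕ} (ha : ¬ IsWord [a]) (k : ℕ) : [a] ∈ MF (CK k) :=
  ⟨fun h => ha h.1, nil_mem_CK k, nil_mem_CK k⟩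

theorem cube_mem_MF {a : ℕ} (ha : a = 1 ∨ a = 2) (k : ℕ) : [a, a, a] ∈ MF (CK (k + 1)) :=
  ⟨fun h => not_diffble_cube [] (mem_CK_succ.1 h).1, pair_mem_CK ha _, pair_mem_CK ha _⟩

theorem eq_singleton_or_cube_of_mem_MF {k : ℕ} {v : Word} (hv : v ∈ MF (CK (k + 1)))
    (h : ¬ Diffble v) : (∃ a, v = [a] ∧ ¬ IsWord v) ∨ v = [1, 1, 1] ∨ v = [2, 2, 2] :=
  eq_singleton_or_cube h (mem_CK_succ.1 hv.2.1).1 (mem_CK_succ.1 hv.2.2).1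

theorem mem_MF_of_not_diffble {j k : ℕ} {v : Word} (hv : v ∈ MF (CK (k + 1)))
    (h : ¬ Diffble v) : v ∈ MF (CK (j + 1)) := by
  rcases eq_singleton_or_cube_of_mem_MF hv h with ⟨a, rfl, ha⟩ | rfl | rfl
  · exact singleton_mem_MF ha _
  · exact cube_mem_MF (.inl rfl) _
  · exact cube_mem_MF (.inr rfl) _

theorem ne_nil_of_mem_MF {k : ℕ} {v : Word} (hv : v ∈ MF (CK k)) : v ≠ [] :=
  fun h => hv.1 (h ▸ nil_mem_CK k)

theorem mem_MF_succ_of_isMinPrimitive {k : ℕ} {v u : Word} (h : IsMinPrimitive v u)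
    (hu : u ∈ MF (CK k)) : v ∈ MF (CK (k + 1)) := by
  have hne := ne_nil_of_mem_MF hu
  refine ⟨fun hv => hu.1 (h.1.2 ▸ (mem_CK_succ.1 hv).2), mem_CK_succ.2 ⟨h.1.1.dropLast, ?_⟩,
    mem_CK_succ.2 ⟨h.1.1.tail, ?_⟩⟩
  · exact h.D_dropLast hne ▸ hu.2.1
  · exact h.D_tail hne ▸ hu.2.2

theorem isMinPrimitive_of_mem_MF_succ {k : ℕ} {v : Word} (hv : v ∈ MF (CK (k + 1)))
    (h : Diffble v) : IsMinPrimitive v (D v) ∧ D v ∈ MF (CK k) := by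
  have hu : D v ∉ CK k := fun hu => hv.1 (mem_CK_succ.2 ⟨h, hu⟩)
  have hp := (mem_CK_succ.1 hv.2.1).2
  have hs := (mem_CK_succ.1 hv.2.2).2
  have hp' : D v.dropLast ≠ D v := fun e => hu (e ▸ hp)
  have hs' : D v.tail ≠ D v := fun e => hu (e ▸ hs)
  refine ⟨isMinPrimitive_of_D_ne h (fun e => hu (e ▸ nil_mem_CK k)) hs' hp', hu, ?_, ?_⟩
  · exact h.D_dropLast.resolve_left hp' ▸ hp
  · exact h.D_tail.resolve_left hs' ▸ hs

theorem MF_CK_subset_succ (k : ℕ) : MF (CK k) ⊆ MF (CK (k + 1)) := by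
  induction k with
  | zero =>
    intro v hv
    have hword : ¬ IsWord v := fun h => hv.1 (mem_CK_zero.2 h)
    have hp := mem_CK_zero.1 hv.2.1
    have hs := mem_CK_zero.1 hv.2.2
    cases v with
    | nil => exact absurd hs hword
    | cons a l =>
      cases l with
      | nil => exact singleton_mem_MF hword _
      | cons b l =>
        refine absurd ?_ hword
        have ha := hp a (by simp)
        simpa [IsWord, ha] using hs
  | succ k ih =>
    intro v hv
    by_cases h : Diffble v
    · obtain ⟨hmin, hu⟩ := isMinPrimitive_of_mem_MF_succ hv h
      exact mem_MF_succ_of_isMinPrimitive hmin (ih hu)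
    · exact mem_MF_of_not_diffble hv h

theorem MF_CK_subset_MF_Cinf (k : ℕ) : MF (CK k) ⊆ MF Cinf := by
  intro v hv
  have hmono : Monotone fun j => MF (CK j) := monotone_nat_of_le_succ MF_CK_subset_succ
  refine ⟨fun h => hv.1 (h k), fun j => ?_, fun j => ?_⟩
  · exact CK_antitone (le_max_right k j) (hmono (le_max_left k j) hv).2.1
  · exact CK_antitone (le_max_right k j) (hmono (le_max_left k j) hv).2.2

/-! ### Heights -/

theorem iterate_D_of_mem_MF {k : ℕ} {u : Word} (hu : u ∈ MF (CK (k + 1))) (h : u ∈ CK k) :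
    D^[k] u = [1, 1, 1] ∨ D^[k] u = [2, 2, 2] := by
  induction k generalizing u with
  | zero =>
    rcases eq_singleton_or_cube_of_mem_MF hu (fun hd => hu.1 (mem_CK_one.2 hd)) with
      ⟨a, -, hw⟩ | h
    · exact absurd h.1 hw
    · exact h
  | succ k ih =>
    rw [mem_CK_succ] at h
    exact ih (isMinPrimitive_of_mem_MF_succ hu h.1).2 h.2

theorem MFheight_eq {k : ℕ} {u : Word} (hu : u ∈ MF (CK (k + 1))) (h : u ∈ CK k) :
    MFheight u = k + 1 := by
  have hmem : k ∈ {k | u ∈ CK k ∧ (D^[k] u = [1, 1, 1] ∨ D^[k] u = [2, 2, 2])} :=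
    ⟨h, iterate_D_of_mem_MF hu h⟩
  refine congrArg (· + 1) (le_antisymm (Nat.sInf_le hmem) (le_csInf ⟨k, hmem⟩ ?_))
  rintro j ⟨-, hj⟩
  by_contra! hlt
  have := h.2 j hlt
  rcases hj with hj | hj <;> exact not_diffble_cube [] (hj ▸ this)

theorem exists_mem_MF_CK {u : Word} (hu : u ∈ MF Cinf) (hword : IsWord u) :
    ∃ k, u ∈ MF (CK (k + 1)) ∧ u ∈ CK k := by
  have hex : ∃ k, u ∉ CK k := by
    by_contra! h
    exact hu.1 h
  classical
  have hspec := Nat.find_spec hex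
  have hmin : ∀ {m}, m < Nat.find hex → ¬ u ∉ CK m := Nat.find_min hex
  generalize Nat.find hex = n at hspec hmin
  cases n with
  | zero => exact absurd (mem_CK_zero.2 hword) hspec
  | succ k => exact ⟨k, ⟨hspec, hu.2.1 _, hu.2.2 _⟩, not_not.1 (hmin k.lt_succ_self)⟩

end CinftyWords

open CinftyWords in
/-- For every `k > 0`, letting `P (k+1)` be the set of primitives of minimal length of
words of `MF(C∞)` of height `k`, one has `MF(C^{k+1}) = MF(C^k) ∪ P (k+1)`. -/
theorem mf_ck_succ_eq_union_min_primitives (k : ℕ) (hk : 0 < k) :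
    MF (CK (k + 1)) = MF (CK k) ∪
      {v | ∃ u ∈ MF Cinf, MFheight u = k ∧ IsPrimitive v u ∧
        ∀ v', IsPrimitive v' u → v.length ≤ v'.length} := by
  obtain ⟨k, rfl⟩ := Nat.exists_eq_succ_of_ne_zero hk.ne'
  refine Set.Subset.antisymm (fun v hv => ?_) (Set.union_subset (MF_CK_subset_succ _) ?_)
  · by_cases hvk : v ∈ CK (k + 1)
    · obtain ⟨h, hD⟩ := mem_CK_succ.1 hvk
      obtain ⟨hmin, hu⟩ := isMinPrimitive_of_mem_MF_succ hv h
      exact .inr ⟨D v, MF_CK_subset_MF_Cinf _ hu, MFheight_eq hu hD, hmin⟩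
    · exact .inl ⟨hvk, CK_antitone (Nat.le_succ _) hv.2.1, CK_antitone (Nat.le_succ _) hv.2.2⟩
  · rintro v ⟨u, hu, hheight, hmin⟩
    obtain ⟨m, hm, hm'⟩ := exists_mem_MF_CK hu (hmin.1.2 ▸ hmin.1.1.isWord_D)
    obtain rfl : m = k := by
      have := MFheight_eq hm hm'
      omega
    exact mem_MF_succ_of_isMinPrimitive hmin hm
end

section
/- For all letters x, y ∈ Σ and every word u ∈ Σ*, the word xuy belongs to MF(C^∞) if and only if x̄uȳ is a minimal C∞-word whose root is the one-letter word 1. -/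
namespace CinftyWords

/-- The word obtained from `l` by deleting its first letter when that letter is `1`. -/
def dropOne : Word → Word
  | [] => []
  | k :: l => if k = 1 then l else k :: l

/-- The word obtained from `l` by deleting its first and/or last letter when equal to `1`. -/
def trim (l : Word) : Word := (dropOne (dropOne l).reverse).reverse

@[simp] theorem dropOne_nil : dropOne [] = [] := rfl

@[simp] theorem dropOne_one_cons (l : Word) : dropOne (1 :: l) = l := rfl

@[simp] theorem dropOne_two_cons (l : Word) : dropOne (2 :: l) = 2 :: l := rfl

theorem map_length_dropFirstRun1 (g : List (List ℕ)) :
    (dropFirstRun1 g).map List.length = dropOne (g.map List.length) := by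
  cases g with
  | nil => rfl
  | cons r rs => simp only [dropFirstRun1, dropOne, List.map_cons]; split_ifs <;> rfl

theorem D_eq_trim_rle (w : Word) : D w = trim (rle w) := by
  simp only [D, trim, rle, List.map_reverse, map_length_dropFirstRun1]

theorem splitBy_loop_eq_append (r : ℕ → ℕ → Bool) (l : Word) (a : ℕ) (g : Word)
    (gs : List Word) :
    List.splitBy.loop r l a g gs = gs.reverse ++ List.splitBy.loop r l a g [] := by
  induction l generalizing a g gs with
  | nil => simp [List.splitBy.loop]
  | cons b l ih =>
    simp only [List.splitBy.loop]
    cases r a b with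
    | true => exact ih _ _ _
    | false =>
      simp only
      rw [ih, ih b [] [_]]
      simp

theorem map_length_splitBy_loop (r : ℕ → ℕ → Bool) (l : Word) (a : ℕ) (g : Word) :
    (List.splitBy.loop r l a g []).map List.length =
      ((List.splitBy.loop r l a [] []).map List.length).modifyHead (· + g.length) := by
  induction l generalizing a g with
  | nil => simp [List.splitBy.loop, add_comm]
  | cons b l ih =>
    simp only [List.splitBy.loop]
    cases r a b with
    | true =>
      simp only
      rw [ih b (a :: g), ih b [a]]
      cases (List.splitBy.loop r l b [] []).map List.length with
      | nil => rfl
      | cons k t => simp; omega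
    | false =>
      simp only
      rw [splitBy_loop_eq_append, splitBy_loop_eq_append (gs := [[a].reverse])]
      simp [add_comm]

@[simp] theorem rle_nil : rle [] = [] := rfl

theorem rle_cons_s12 (x : ℕ) (u : Word) :
    rle (x :: u) = if u.head? = some x then (rle u).modifyHead (· + 1) else 1 :: rle u := by
  cases u with
  | nil => rfl
  | cons a u =>
    simp only [rle, List.splitBy, List.splitBy.loop, List.head?_cons, Option.some.injEq]
    by_cases h : x = a
    · subst h
      simp only [beq_self_eq_true, if_true]
      rw [map_length_splitBy_loop]
      simp
    · have h' : (x == a) = false := by simpa using h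
      rw [h', if_neg (Ne.symm h)]
      simp only
      rw [splitBy_loop_eq_append]
      simp

theorem rle_eq_nil {w : Word} : rle w = [] ↔ w = [] := by
  simp [rle]

theorem modifyHead_modifyLast (f : ℕ → ℕ) (l : Word) :
    (l.modifyLast f).modifyHead f = (l.modifyHead f).modifyLast f := by
  rcases l.eq_nil_or_concat' with rfl | ⟨L, b, rfl⟩
  · rfl
  · rw [List.modifyLast_concat]
    cases L with
    | nil => exact (List.modifyLast_concat f (f b) []).symm
    | cons c L =>
      simp only [List.cons_append, List.modifyHead_cons]
      rw [← List.cons_append, ← List.cons_append, List.modifyLast_concat]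

theorem rle_append_singleton (u : Word) (y : ℕ) :
    rle (u ++ [y]) =
      if u.getLast? = some y then (rle u).modifyLast (· + 1) else rle u ++ [1] := by
  induction u with
  | nil => rfl
  | cons a u ih =>
    cases u with
    | nil =>
      have h := List.modifyLast_concat (· + 1) 1 ([] : Word)
      simp only [List.nil_append] at h
      by_cases hay : a = y
      · subst hay; simp [rle_cons_s12, h]
      · simp [rle_cons_s12, hay, Ne.symm hay]
    | cons b u =>
      have hne : rle (b :: u) ≠ [] := by simp [rle_eq_nil]
      rw [List.cons_append, rle_cons_s12, ih, rle_cons_s12 a (b :: u), List.getLast?_cons_cons]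
      rw [List.cons_append, List.head?_cons, List.head?_cons]
      obtain ⟨L, k, hL⟩ := (rle (b :: u)).eq_nil_or_concat'.resolve_left hne
      rw [hL]
      by_cases hba : some b = some a <;> by_cases hy : (b :: u).getLast? = some y <;>
        simp only [hba, hy, if_true, if_false]
      · exact modifyHead_modifyLast _ _
      · cases L <;> simp
      · rw [List.modifyLast_concat, ← List.cons_append, ← List.cons_append,
          List.modifyLast_concat]
      · simp

theorem rle_pos {w : Word} {k : ℕ} (hk : k ∈ rle w) : 0 < k := by
  obtain ⟨g, hg, rfl⟩ := List.mem_map.1 hk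
  exact List.length_pos_iff.2 (List.ne_nil_of_mem_splitBy hg)

theorem IsWord.of_rle_cons {x : ℕ} {u : Word} (h : IsWord (rle (x :: u))) :
    IsWord (rle u) := by
  have hpos := @rle_pos u
  rw [rle_cons_s12] at h
  split_ifs at h
  · cases hu : rle u with
    | nil => simp [IsWord]
    | cons k t =>
      simp only [IsWord, hu, List.modifyHead_cons, List.forall_mem_cons] at h hpos ⊢
      exact ⟨by have := hpos.1; omega, h.2⟩
  · exact fun k hk => h k (List.mem_cons_of_mem _ hk)

theorem IsWord.of_rle_append_singleton {y : ℕ} {u : Word} (h : IsWord (rle (u ++ [y]))) :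
    IsWord (rle u) := by
  have hpos := @rle_pos u
  rw [rle_append_singleton] at h
  split_ifs at h
  · rcases (rle u).eq_nil_or_concat' with hu | ⟨L, k, hu⟩
    · simp [hu, IsWord]
    · rw [hu] at h hpos ⊢
      rw [List.modifyLast_concat] at h
      simp only [IsWord, List.forall_mem_append, List.forall_mem_singleton] at h ⊢
      have := @hpos k (by simp)
      exact ⟨h.1, by omega⟩
  · exact fun k hk => h k (List.mem_append_left _ hk)

theorem mem_Cinf_iff {w : Word} : w ∈ Cinf ↔ Diffble w ∧ D w ∈ Cinf := by
  constructor
  · intro h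
    refine ⟨(h 1).2 0 one_pos, fun k => ⟨?_, fun j hj => ?_⟩⟩
    · exact ((h 2).2 1 (by norm_num)).1
    · exact (h (k + 1)).2 (j + 1) (by omega)
  · rintro ⟨h, h'⟩ k
    refine ⟨h.1, fun j hj => ?_⟩
    cases j with
    | zero => exact h
    | succ j => exact (h' (j + 1)).2 j (by omega)

theorem diffble_of_mem_Cinf {w : Word} (h : w ∈ Cinf) : Diffble w := (mem_Cinf_iff.1 h).1

theorem iterate_D_nil (n : ℕ) : D^[n] [] = [] :=
  Function.iterate_fixed rfl n

theorem nil_mem_Cinf : ([] : Word) ∈ Cinf :=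
  fun _ => ⟨by simp [IsWord], fun j _ => by rw [iterate_D_nil]; simp [Diffble, IsWord]⟩

theorem singleton_mem_Cinf {x : ℕ} (hx : x = 1 ∨ x = 2) : [x] ∈ Cinf :=
  mem_Cinf_iff.2 ⟨by simp [Diffble, IsWord, rle_cons_s12, hx], nil_mem_Cinf⟩

theorem pair_mem_Cinf {x y : ℕ} (hx : x = 1 ∨ x = 2) (hy : y = 1 ∨ y = 2) :
    [x, y] ∈ Cinf := by
  rw [mem_Cinf_iff]
  by_cases h : y = x
  · have hD : D [x, y] = [2] := by simp [D_eq_trim_rle, rle_cons_s12, h, trim]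
    rw [hD]
    exact ⟨by simp [Diffble, IsWord, rle_cons_s12, hx, h], singleton_mem_Cinf (Or.inr rfl)⟩
  · have hD : D [x, y] = [] := by simp [D_eq_trim_rle, rle_cons_s12, h, trim]
    rw [hD]
    exact ⟨by simp [Diffble, IsWord, rle_cons_s12, hx, hy, h], nil_mem_Cinf⟩

theorem height_eq_of_iterate_D_eq_one {w : Word} {n : ℕ} (h : D^[n] w = [1]) :
    height w = n + 1 := by
  have hmem : D^[n + 1] w = [] := by rw [Function.iterate_succ_apply', h]; rfl
  refine le_antisymm (Nat.sInf_le hmem) (le_csInf ⟨_, hmem⟩ fun k hk => ?_)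
  by_contra! hlt
  obtain ⟨d, rfl⟩ := Nat.exists_eq_add_of_le (Nat.lt_succ_iff.1 hlt)
  rw [Set.mem_ofPred_eq] at hk
  rw [add_comm, Function.iterate_add_apply, hk, iterate_D_nil] at h
  simp at h

theorem root_eq_one_iff {w : Word} : root w = [1] ↔ ∃ n, D^[n] w = [1] := by
  refine ⟨fun h => ⟨_, h⟩, fun ⟨n, h⟩ => ?_⟩
  rw [root, height_eq_of_iterate_D_eq_one h]
  exact h

/-- `w` is a minimal C∞-word whose root is the one-letter word `1`. -/
def MinimalRootOne (w : Word) : Prop := w ∈ Cinf ∧ MinimalWord w ∧ root w = [1]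

/-- For words with at least two letters, being minimal with root `1` is inherited from the
derivative exactly by its shortest primitives. -/
theorem minimalRootOne_iff_derivative {w : Word} (hw : 2 ≤ w.length) :
    MinimalRootOne w ↔
      Diffble w ∧ MinimalRootOne (D w) ∧ ∀ v, IsPrimitive v (D w) → w.length ≤ v.length := by
  constructor
  · rintro ⟨hC, ⟨-, -, hmin⟩, hroot⟩
    obtain ⟨n, hn⟩ := root_eq_one_iff.1 hroot
    cases n with
    | zero => simp only [Function.iterate_zero, id_eq] at hn; simp [hn] at hw
    | succ n =>
      rw [height_eq_of_iterate_D_eq_one hn] at hmin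
      rw [Function.iterate_succ_apply] at hn
      have hC' := mem_Cinf_iff.1 hC
      refine ⟨hC'.1, ⟨hC'.2, ⟨hC'.2, fun h => ?_, fun j hj => ?_⟩, root_eq_one_iff.2 ⟨n, hn⟩⟩,
        hmin 0 (by omega)⟩
      · rw [h, iterate_D_nil] at hn
        simp at hn
      · rw [height_eq_of_iterate_D_eq_one hn] at hj
        exact hmin (j + 1) (by omega)
  · rintro ⟨hd, ⟨hC, ⟨-, -, hmin⟩, hroot⟩, hlen⟩
    obtain ⟨n, hn⟩ := root_eq_one_iff.1 hroot
    rw [height_eq_of_iterate_D_eq_one hn] at hmin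
    have hn' : D^[n + 1] w = [1] := hn
    have hC' := mem_Cinf_iff.2 ⟨hd, hC⟩
    refine ⟨hC', ⟨hC', fun h => by simp [h] at hw, fun j hj => ?_⟩,
      root_eq_one_iff.2 ⟨_, hn'⟩⟩
    rw [height_eq_of_iterate_D_eq_one hn'] at hj
    cases j with
    | zero => exact hlen
    | succ j => exact hmin j (by omega)

theorem not_minimalRootOne_of_shorter {w v : Word} (hw : 2 ≤ w.length) (hD : D w = D v)
    (hv : Diffble v) (hlt : v.length < w.length) : ¬ MinimalRootOne w := fun h =>
  absurd (((minimalRootOne_iff_derivative hw).1 h).2.2 v ⟨hv, hD.symm⟩) (not_le.2 hlt)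

theorem mem_MF_iff {x y : ℕ} {u : Word} :
    x :: (u ++ [y]) ∈ MF Cinf ↔
      x :: (u ++ [y]) ∉ Cinf ∧ x :: u ∈ Cinf ∧ u ++ [y] ∈ Cinf := by
  rw [MF, Set.mem_ofPred_eq, ← List.cons_append, List.dropLast_concat]
  rfl

theorem dropOne_eq_cons {l t : Word} {p : ℕ} (h : dropOne l = p :: t) :
    l = p :: t ∧ p ≠ 1 ∨ l = 1 :: p :: t := by
  cases l with
  | nil => simp at h
  | cons k l =>
    simp only [dropOne] at h
    split_ifs at h with hk
    · right; rw [hk, h]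
    · left; exact ⟨h, by simp only [List.cons.injEq] at h; omega⟩

theorem le_sum_of_trim_eq {l K : Word} {p q : ℕ} (hp : p = 1 ∨ p = 2) (hq : q = 1 ∨ q = 2)
    (h : trim l = p :: (K ++ [q])) : K.sum + 4 ≤ l.sum := by
  have h1 : dropOne (dropOne l).reverse = q :: (K.reverse ++ [p]) := by
    rw [← List.reverse_reverse (dropOne _), ← trim, h]; simp
  rcases dropOne_eq_cons h1 with ⟨h2, hq1⟩ | h2 <;>
  · rw [List.reverse_eq_iff] at h2
    simp only [List.reverse_cons, List.reverse_append, List.reverse_reverse,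
      List.reverse_nil, List.nil_append, List.cons_append] at h2
    rcases dropOne_eq_cons h2 with ⟨rfl, hp1⟩ | rfl <;> simp <;> omega

theorem trim_eq_one {l : Word} (h : trim l = [1]) : l = [1, 1, 1] := by
  have h1 : dropOne (dropOne l).reverse = [1] := by
    rw [← List.reverse_reverse (dropOne _), ← trim, h]; simp
  rcases dropOne_eq_cons h1 with ⟨-, h2⟩ | h2
  · exact absurd rfl h2
  · rw [List.reverse_eq_iff] at h2
    rcases dropOne_eq_cons h2 with ⟨-, h3⟩ | h3
    · exact absurd rfl h3
    · exact h3

theorem bar_letter {x : ℕ} (hx : x = 1 ∨ x = 2) : bar x = 1 ∨ bar x = 2 := by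
  rcases hx with rfl | rfl <;> simp [bar]

theorem IsWord.cons {x : ℕ} {u : Word} (hx : x = 1 ∨ x = 2) (hu : IsWord u) :
    IsWord (x :: u) := List.forall_mem_cons.2 ⟨hx, hu⟩

theorem IsWord.append_singleton {y : ℕ} {u : Word} (hu : IsWord u) (hy : y = 1 ∨ y = 2) :
    IsWord (u ++ [y]) := List.forall_mem_append.2 ⟨hu, List.forall_mem_singleton.2 hy⟩

theorem head?_append_singleton {u : Word} (hu : u ≠ []) (y : ℕ) :
    (u ++ [y]).head? = u.head? := List.head?_append_of_ne_nil _ hu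

theorem getLast?_cons_of_ne_nil {u : Word} (hu : u ≠ []) (x : ℕ) :
    (x :: u).getLast? = u.getLast? := by
  cases u with
  | nil => exact absurd rfl hu
  | cons a u => exact List.getLast?_cons_cons

section LongEndRun

variable {x y : ℕ} {u L : Word}

theorem diffble_and_D_eq_of_first_run_two (hx : x = 1 ∨ x = 2) (hL : rle u = 2 :: L)
    (hxu : IsWord (rle (x :: u))) (hd : Diffble (u ++ [y])) :
    Diffble (x :: (u ++ [y])) ∧ D (x :: (u ++ [y])) = D (u ++ [y]) := by
  have hu : u ≠ [] := by rintro rfl; simp at hL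
  have hne : ¬ u.head? = some x := by
    intro h
    rw [rle_cons_s12, if_pos h, hL] at hxu
    have := hxu 3 (by simp)
    omega
  have hrle : rle (x :: (u ++ [y])) = 1 :: rle (u ++ [y]) := by
    rw [rle_cons_s12, head?_append_singleton hu, if_neg hne]
  have hhead : dropOne (rle (u ++ [y])) = rle (u ++ [y]) := by
    rw [rle_append_singleton, hL]
    split_ifs
    · rcases L.eq_nil_or_concat' with rfl | ⟨M, k, rfl⟩
      · rfl
      · rw [← List.cons_append, List.modifyLast_concat]; rfl
    · rfl
  refine ⟨⟨hd.1.cons hx, ?_⟩, ?_⟩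
  · rw [hrle]; exact hd.2.cons (Or.inl rfl)
  · rw [D_eq_trim_rle, D_eq_trim_rle, hrle, trim, trim, dropOne_one_cons, hhead]

theorem trim_append_two_one (L : Word) : trim (L ++ [2] ++ [1]) = trim (L ++ [2]) := by
  cases L with
  | nil => rfl
  | cons k L =>
    simp only [trim, dropOne, List.cons_append]
    split_ifs <;> simp

theorem diffble_and_D_eq_of_last_run_two (hy : y = 1 ∨ y = 2) (hL : rle u = L ++ [2])
    (huy : IsWord (rle (u ++ [y]))) (hd : Diffble (x :: u)) :
    Diffble (x :: (u ++ [y])) ∧ D (x :: (u ++ [y])) = D (x :: u) := by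
  have hu : u ≠ [] := by rintro rfl; simp at hL
  have hne : ¬ u.getLast? = some y := by
    intro h
    rw [rle_append_singleton, if_pos h, hL, List.modifyLast_concat] at huy
    have := huy 3 (by simp)
    omega
  have hrle : rle (x :: u ++ [y]) = rle (x :: u) ++ [1] := by
    rw [rle_append_singleton, getLast?_cons_of_ne_nil hu, if_neg hne]
  have hlast : ∃ M, rle (x :: u) = M ++ [2] := by
    have hd2 := hd.2
    rw [rle_cons_s12, hL] at hd2 ⊢
    split_ifs at hd2 ⊢
    · cases L with
      | nil =>
        have := hd2 3 (by simp)
        omega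
      | cons k L => exact ⟨(k + 1) :: L, rfl⟩
    · exact ⟨1 :: L, rfl⟩
  obtain ⟨M, hM⟩ := hlast
  rw [← List.cons_append]
  refine ⟨⟨hd.1.append_singleton hy, ?_⟩, ?_⟩
  · rw [hrle]; exact hd.2.append_singleton (Or.inl rfl)
  · rw [D_eq_trim_rle, D_eq_trim_rle, hrle, hM, trim_append_two_one]

end LongEndRun

section ShortEndRuns

variable {u K : Word}

theorem rle_bracket (h : rle u = 1 :: (K ++ [1])) (x y : ℕ) :
    rle (x :: (u ++ [y])) = (if u.head? = some x then [2] else [1, 1]) ++ K ++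
      (if u.getLast? = some y then [2] else [1, 1]) := by
  have hu : u ≠ [] := by rintro rfl; simp at h
  rw [rle_cons_s12, head?_append_singleton hu, rle_append_singleton, h, ← List.cons_append,
    List.modifyLast_concat]
  split_ifs <;> simp

theorem D_bracket (h : rle u = 1 :: (K ++ [1])) (x y : ℕ) :
    D (x :: (u ++ [y])) = (if u.head? = some x then 2 else 1) ::
      (K ++ [if u.getLast? = some y then 2 else 1]) := by
  rw [D_eq_trim_rle, rle_bracket h]
  split_ifs <;> simp [trim]

theorem D_cons_of_rle (h : rle u = 1 :: (K ++ [1])) (x : ℕ) :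
    D (x :: u) = (if u.head? = some x then 2 else 1) :: K := by
  rw [D_eq_trim_rle, rle_cons_s12, h]
  split_ifs <;> simp [trim]

theorem D_append_singleton_of_rle (h : rle u = 1 :: (K ++ [1])) (y : ℕ) :
    D (u ++ [y]) = K ++ [if u.getLast? = some y then 2 else 1] := by
  rw [D_eq_trim_rle, rle_append_singleton, h, ← List.cons_append, List.modifyLast_concat]
  split_ifs <;> simp [trim]

theorem diffble_bracket (h : rle u = 1 :: (K ++ [1])) (hK : IsWord K) (hu : IsWord u) {x y : ℕ}
    (hx : x = 1 ∨ x = 2) (hy : y = 1 ∨ y = 2) : Diffble (x :: (u ++ [y])) := by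
  refine ⟨(hu.append_singleton hy).cons hx, ?_⟩
  rw [rle_bracket h]
  simp only [IsWord] at hK ⊢
  split_ifs <;> simp +contextual [or_imp, hK]

theorem diffble_cons_of_rle (h : rle u = 1 :: (K ++ [1])) (hK : IsWord K) (hu : IsWord u) {x : ℕ}
    (hx : x = 1 ∨ x = 2) : Diffble (x :: u) := by
  have := (diffble_bracket h hK hu hx hx).2
  rw [← List.cons_append] at this
  exact ⟨hu.cons hx, this.of_rle_append_singleton⟩

theorem diffble_append_singleton_of_rle (h : rle u = 1 :: (K ++ [1])) (hK : IsWord K)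
    (hu : IsWord u) {y : ℕ} (hy : y = 1 ∨ y = 2) : Diffble (u ++ [y]) :=
  ⟨hu.append_singleton hy, (diffble_bracket h hK hu hy hy).2.of_rle_cons⟩

theorem mem_MF_iff_D_mem_MF (h : rle u = 1 :: (K ++ [1])) (hK : IsWord K) (hu : IsWord u)
    {x y : ℕ} (hx : x = 1 ∨ x = 2) (hy : y = 1 ∨ y = 2) :
    x :: (u ++ [y]) ∈ MF Cinf ↔ D (x :: (u ++ [y])) ∈ MF Cinf := by
  rw [mem_MF_iff, mem_Cinf_iff (w := x :: (u ++ [y])), mem_Cinf_iff (w := x :: u),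
    mem_Cinf_iff (w := u ++ [y]), D_bracket h, mem_MF_iff, D_cons_of_rle h,
    D_append_singleton_of_rle h]
  simp only [diffble_bracket h hK hu hx hy, diffble_cons_of_rle h hK hu hx,
    diffble_append_singleton_of_rle h hK hu hy, true_and]

theorem minimalRootOne_iff_D_minimalRootOne (h : rle u = 1 :: (K ++ [1])) (hK : IsWord K)
    (hu : IsWord u) {x y : ℕ} (hx : x = 1 ∨ x = 2) (hy : y = 1 ∨ y = 2) :
    MinimalRootOne (x :: (u ++ [y])) ↔ MinimalRootOne (D (x :: (u ++ [y]))) := by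
  rw [minimalRootOne_iff_derivative (by simp)]
  refine ⟨fun hm => hm.2.1, fun hm => ⟨diffble_bracket h hK hu hx hy, hm, ?_⟩⟩
  rintro v ⟨-, hv⟩
  rw [D_bracket h, D_eq_trim_rle] at hv
  have hsum := le_sum_of_trim_eq (by split_ifs <;> simp) (by split_ifs <;> simp) hv
  have hlen := sum_rle u
  rw [sum_rle] at hsum
  simp [h] at hlen
  simp
  omega

end ShortEndRuns

theorem not_iterate_D_two_eq_one (n : ℕ) : D^[n] [2] ≠ [1] := by
  cases n with
  | zero => simp
  | succ n =>
    have h : D [2] = [] := by simp [D_eq_trim_rle, rle_cons_s12, trim]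
    rw [Function.iterate_succ_apply, h, iterate_D_nil]
    simp

theorem not_minimalRootOne_of_D {w : Word} (hw : 2 ≤ w.length) (h : D w = [] ∨ D w = [2]) :
    ¬ MinimalRootOne w := by
  intro hm
  obtain ⟨n, hn⟩ := root_eq_one_iff.1 ((minimalRootOne_iff_derivative hw).1 hm).2.1.2.2
  rcases h with h | h <;> rw [h] at hn
  · rw [iterate_D_nil] at hn; simp at hn
  · exact not_iterate_D_two_eq_one n hn

theorem minimalRootOne_one : MinimalRootOne [1] := by
  have h : D^[0] [1] = [1] := rfl
  refine ⟨singleton_mem_Cinf (Or.inl rfl), ⟨singleton_mem_Cinf (Or.inl rfl), by simp, ?_⟩,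
    root_eq_one_iff.2 ⟨0, h⟩⟩
  intro j hj
  rw [height_eq_of_iterate_D_eq_one h] at hj
  omega

theorem mem_MF_triple {x a y : ℕ} (hx : x = 1 ∨ x = 2) (ha : a = 1 ∨ a = 2)
    (hy : y = 1 ∨ y = 2) : [x, a, y] ∈ MF Cinf ↔ x = a ∧ y = a := by
  have h := mem_MF_iff (x := x) (y := y) (u := [a])
  simp only [List.cons_append, List.nil_append, pair_mem_Cinf hx ha, pair_mem_Cinf ha hy,
    and_true] at h
  rw [h]
  by_cases hxa : a = x <;> by_cases hya : y = a
  · subst hxa hya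
    simp only [and_self, iff_true]
    intro hC
    have := (diffble_of_mem_Cinf hC).2 3 (by simp [rle_cons_s12])
    omega
  all_goals
    have hrle : rle [x, a, y] = (if a = x then (if y = a then [3] else [2, 1]) else
        if y = a then [1, 2] else [1, 1, 1]) := by
      simp [rle_cons_s12]
      split_ifs
      rfl
    split_ifs at hrle
    refine iff_of_false (not_not.2 (mem_Cinf_iff.2 ⟨⟨?_, ?_⟩, ?_⟩)) (by tauto)
    · simp [IsWord, hx, ha, hy]
    · simp [IsWord, hrle]
    · rw [D_eq_trim_rle, hrle]
      simp [trim, singleton_mem_Cinf]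

theorem minimalRootOne_triple {x a y : ℕ} (hx : x = 1 ∨ x = 2) (ha : a = 1 ∨ a = 2)
    (hy : y = 1 ∨ y = 2) : MinimalRootOne [x, a, y] ↔ x ≠ a ∧ y ≠ a := by
  by_cases hxa : a = x <;> by_cases hya : y = a
  · refine iff_of_false (fun hm => ?_) (by tauto)
    have := (diffble_of_mem_Cinf hm.1).2 3 (by simp [rle_cons_s12, hxa, hya])
    omega
  · refine iff_of_false (not_minimalRootOne_of_D (by simp) (Or.inr ?_)) (by tauto)
    simp [D_eq_trim_rle, rle_cons_s12, hxa, hxa ▸ hya, trim]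
  · refine iff_of_false (not_minimalRootOne_of_D (by simp) (Or.inr ?_)) (by tauto)
    simp [D_eq_trim_rle, rle_cons_s12, hxa, hya, trim]
  · refine iff_of_true ?_ ⟨Ne.symm hxa, hya⟩
    have hD : D [x, a, y] = [1] := by simp [D_eq_trim_rle, rle_cons_s12, hxa, hya, trim]
    rw [minimalRootOne_iff_derivative (by simp), hD]
    refine ⟨by simp [Diffble, IsWord, rle_cons_s12, hx, ha, hy, hxa, hya], minimalRootOne_one, ?_⟩
    rintro v ⟨-, hv⟩
    rw [D_eq_trim_rle] at hv
    rw [← sum_rle v, trim_eq_one hv]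
    simp

theorem ite_bar_eq {o : Option ℕ} {a x : ℕ} (ho : o = some a) (ha : a = 1 ∨ a = 2)
    (hx : x = 1 ∨ x = 2) :
    (if o = some (bar x) then 2 else 1) = bar (if o = some x then 2 else 1) := by
  subst ho
  rcases ha with rfl | rfl <;> rcases hx with rfl | rfl <;> simp [bar]

theorem bar_eq_iff {x a : ℕ} (hx : x = 1 ∨ x = 2) (ha : a = 1 ∨ a = 2) :
    bar x ≠ a ↔ x = a := by
  rcases hx with rfl | rfl <;> rcases ha with rfl | rfl <;> simp [bar]

theorem mem_MF_iff_minimalRootOne (u : Word) (hu : IsWord u) (x y : ℕ) (hx : x = 1 ∨ x = 2)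
    (hy : y = 1 ∨ y = 2) :
    x :: (u ++ [y]) ∈ MF Cinf ↔ MinimalRootOne (bar x :: (u ++ [bar y])) := by
  induction hn : u.length using Nat.strong_induction_on generalizing u x y with
  | _ n ih =>
  have hbx := bar_letter hx
  have hby := bar_letter hy
  by_cases hR : IsWord (rle u)
  swap
  · exact iff_of_false (fun h => hR (diffble_of_mem_Cinf (mem_MF_iff.1 h).2.1).2.of_rle_cons)
      (fun h => hR (diffble_of_mem_Cinf h.1).2.of_rle_cons.of_rle_append_singleton)
  cases hru : rle u with
  | nil =>
    obtain rfl := rle_eq_nil.1 hru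
    refine iff_of_false (fun h => (mem_MF_iff.1 h).1 (pair_mem_Cinf hx hy))
      (not_minimalRootOne_of_D (by simp) ?_)
    by_cases h : bar y = bar x
    · right; simp [D_eq_trim_rle, rle_cons_s12, h, trim]
    · left; simp [D_eq_trim_rle, rle_cons_s12, h, trim]
  | cons k L =>
    obtain ⟨hk, hL⟩ := List.forall_mem_cons.1 (hru ▸ hR)
    obtain rfl | rfl := hk.symm
    · constructor
      · intro h
        obtain ⟨h1, h2, h3⟩ := mem_MF_iff.1 h
        obtain ⟨hd, hD⟩ := diffble_and_D_eq_of_first_run_two hx hru (diffble_of_mem_Cinf h2).2 (diffble_of_mem_Cinf h3)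
        exact absurd (mem_Cinf_iff.2 ⟨hd, hD ▸ (mem_Cinf_iff.1 h3).2⟩) h1
      · intro h
        have hd := diffble_of_mem_Cinf h.1
        have hd' : Diffble (u ++ [bar y]) := ⟨hu.append_singleton hby, hd.2.of_rle_cons⟩
        have hxu : IsWord (rle (bar x :: u)) := by
          have := hd.2
          rw [← List.cons_append] at this
          exact this.of_rle_append_singleton
        exact absurd h (not_minimalRootOne_of_shorter (by simp)
          (diffble_and_D_eq_of_first_run_two hbx hru hxu hd').2 hd' (by simp))
    rcases L.eq_nil_or_concat' with rfl | ⟨K, q, rfl⟩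
    · have hlen := sum_rle u
      rw [hru] at hlen
      obtain ⟨a, rfl⟩ := List.length_eq_one_iff.1 (hlen.symm.trans (by simp))
      have ha := hu a (by simp)
      have h1 := mem_MF_triple hx ha hy
      have h2 := minimalRootOne_triple hbx ha hby
      rw [bar_eq_iff hx ha, bar_eq_iff hy ha] at h2
      exact h1.trans h2.symm
    obtain ⟨hK, hq⟩ := List.forall_mem_append.1 hL
    obtain rfl | rfl := (List.forall_mem_singleton.1 hq).symm
    · rw [← List.cons_append] at hru
      constructor
      · intro h
        obtain ⟨h1, h2, h3⟩ := mem_MF_iff.1 h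
        obtain ⟨hd, hD⟩ := diffble_and_D_eq_of_last_run_two hy hru (diffble_of_mem_Cinf h3).2 (diffble_of_mem_Cinf h2)
        exact absurd (mem_Cinf_iff.2 ⟨hd, hD ▸ (mem_Cinf_iff.1 h2).2⟩) h1
      · intro h
        have hd := diffble_of_mem_Cinf h.1
        have hd' : Diffble (bar x :: u) := ⟨hu.cons hbx, by
          have := hd.2
          rw [← List.cons_append] at this
          exact this.of_rle_append_singleton⟩
        exact absurd h (not_minimalRootOne_of_shorter (by simp)
          (diffble_and_D_eq_of_last_run_two hby hru hd.2.of_rle_cons hd').2 hd' (by simp))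
    · have hne : u ≠ [] := by rintro rfl; simp at hru
      rw [mem_MF_iff_D_mem_MF hru hK hu hx hy,
        minimalRootOne_iff_D_minimalRootOne hru hK hu hbx hby, D_bracket hru, D_bracket hru,
        ite_bar_eq (List.head?_eq_some_head hne) (hu _ (List.head_mem hne)) hx,
        ite_bar_eq (List.getLast?_eq_some_getLast hne) (hu _ (List.getLast_mem hne)) hy]
      have hsum := sum_rle u
      have hKle : K.length ≤ K.sum := List.length_le_sum_of_one_le K fun i hi => by
        have := hK i hi
        omega
      simp only [hru, List.sum_cons, List.sum_append, List.sum_nil] at hsum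
      exact ih K.length (by omega) K hK _ _ (by split_ifs <;> simp) (by split_ifs <;> simp) rfl

end CinftyWords

open CinftyWords in
/-- For letters `x, y` and a word `u` over Σ: `xuy ∈ MF(C∞)` iff `x̄uȳ` is a minimal
C∞-word whose root is the one-letter word `1`. -/
theorem mf_iff_complement_minimal_root_one (x y : ℕ) (hx : x = 1 ∨ x = 2)
    (hy : y = 1 ∨ y = 2) (u : Word) (hu : IsWord u) :
    x :: (u ++ [y]) ∈ MF Cinf ↔
      (bar x :: (u ++ [bar y]) ∈ Cinf ∧ MinimalWord (bar x :: (u ++ [bar y])) ∧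
        root (bar x :: (u ++ [bar y])) = [1]) := by
  exact mem_MF_iff_minimalRootOne u hu x y hx hy
end
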